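/- Let Γ be a finite group acting linearly on V and on V^∨ compatibly with the pairing (⟨γ·x, γ·y⟩ = ⟨x, y⟩), preserving the root system Φ, the coroot system Φ^∨ (with γ·(α^∨) = (γ·α)^∨), and the base Δ. Let Δ_M ⊆ Δ be a Γ-stable subset, and let ν ∈ V^∨ be non-negative, Γ-invariant, and M-central. Then there exist a chain of Γ-stable subsets Δ_M = Δ_0 ⊆ Δ_1 ⊆ ⋯ ⊆ Δ_k = Δ and vectors ν = ν_0, ν_1, …, ν_k = av_G(ν) in V^∨, each Γ-invariant and non-negative, such that: (1) ν_j = av_{M_j}(ν_i) for all j ≥ i (where av_{M_j} is the average over the subgroup of the Weyl group generated by reflections in Δ_j), and (2) ν_i is M_{i+1}-dominant, i.e. ⟨α, ν_i⟩ ≥ 0 for all α ∈ Δ_{i+1}. -/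

import Mathlib

open scoped BigOperators Classical

/-- A finite crystallographic reduced root system `Φ` (with coroots) in a ℚ-vector space `V`,
together with a fixed base `Δ` of simple roots. -/
structure RootSystemData (V V' : Type) [AddCommGroup V] [Module ℚ V]
    [AddCommGroup V'] [Module ℚ V'] where
  /-- the canonical pairing `⟨·,·⟩ : V × V^∨ → ℚ` -/
  pair : V →ₗ[ℚ] V' →ₗ[ℚ] ℚ
  /-- the finite set of roots `Φ ⊆ V` -/
  roots : Finset V
  /-- the coroot `α^∨ ∈ V^∨` attached to a root `α` -/
  coroot : V → V'
  /-- the base `Δ ⊆ Φ` of simple roots -/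
  base : Finset V
  base_subset : base ⊆ roots
  pair_self : ∀ α ∈ roots, pair α (coroot α) = 2
  root_reflect : ∀ α ∈ roots, ∀ β ∈ roots, β - pair β (coroot α) • α ∈ roots
  coroot_reflect : ∀ α ∈ roots, ∀ β ∈ roots,
      coroot β - pair α (coroot β) • coroot α = coroot (β - pair β (coroot α) • α)
  crystallographic : ∀ α ∈ roots, ∀ β ∈ roots, ∃ n : ℤ, pair β (coroot α) = n
  reduced : ∀ α ∈ roots, ∀ t : ℚ, t • α ∈ roots → t = 1 ∨ t = -1
  base_indep : LinearIndependent ℚ (fun a : base => (a : V))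
  root_pos_or_neg : ∀ β ∈ roots,
      (∃ c : V → ℚ, (∀ α, 0 ≤ c α) ∧ β = ∑ α ∈ base, c α • α) ∨
      (∃ c : V → ℚ, (∀ α, 0 ≤ c α) ∧ -β = ∑ α ∈ base, c α • α)

namespace RootSystemData

variable {V V' : Type} [AddCommGroup V] [Module ℚ V] [AddCommGroup V'] [Module ℚ V']
variable (P : RootSystemData V V')

/-- The pair of reflections `(s_α on V, s_α on V^∨)` attached to a root `α`. -/
noncomputable def reflPair (α : V) (hα : α ∈ P.roots) :
    (V ≃ₗ[ℚ] V) × (V' ≃ₗ[ℚ] V') :=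
  (Module.reflection (f := P.pair.flip (P.coroot α)) (x := α) (P.pair_self α hα),
   Module.reflection (f := P.pair α) (x := P.coroot α) (P.pair_self α hα))

/-- The subgroup `W_M` generated by the reflections `s_α` for `α ∈ Δ_M`, acting
compatibly on `V` and `V^∨`. -/
noncomputable def weyl (ΔM : Finset V) : Subgroup ((V ≃ₗ[ℚ] V) × (V' ≃ₗ[ℚ] V')) :=
  Subgroup.closure { g | ∃ (α : V) (hα : α ∈ P.roots), α ∈ ΔM ∧ g = P.reflPair α hα }

/-- The `M`-average `av_M(ν) = (1/|W_M|) ∑_{w ∈ W_M} w·ν` of `ν ∈ V^∨`. -/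
noncomputable def avg (ΔM : Finset V) (ν : V') : V' :=
  (Nat.card (P.weyl ΔM) : ℚ)⁻¹ •
    ∑ᶠ w : P.weyl ΔM, ((w : (V ≃ₗ[ℚ] V) × (V' ≃ₗ[ℚ] V')).2 ν)

/-- The set `Φ^+` of positive roots with respect to the base `Δ`. -/
noncomputable def posRoots : Finset V :=
  P.roots.filter fun β => ∃ c : V → ℚ, (∀ α, 0 ≤ c α) ∧ β = ∑ α ∈ P.base, c α • α

/-- `ρ_G`, the half sum of the positive roots. -/
noncomputable def rho : V := (2 : ℚ)⁻¹ • ∑ α ∈ P.posRoots, α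

/-- `ρ_M`, the half sum of the positive roots lying in the span of `Δ_M`. -/
noncomputable def rhoLevi (ΔM : Finset V) : V :=
  (2 : ℚ)⁻¹ • ∑ α ∈ P.posRoots.filter
      (fun β => β ∈ Submodule.span ℚ (ΔM : Set V)), α

/-- `ν ∈ V^∨` is central if `⟨α, ν⟩ = 0` for all `α ∈ Φ`. -/
def IsCentral (ν : V') : Prop := ∀ α ∈ P.roots, P.pair α ν = 0

/-- `ν ∈ V^∨` is non-negative if `ν = z + ∑_{α ∈ Δ} c_α • α^∨` with `z` central and
all `c_α ≥ 0`. -/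
def IsNonneg (ν : V') : Prop :=
  ∃ (z : V') (c : V → ℚ), P.IsCentral z ∧ (∀ α, 0 ≤ c α) ∧
    ν = z + ∑ α ∈ P.base, c α • P.coroot α

section Averages

variable {V V' : Type} [AddCommGroup V] [Module ℚ V] [AddCommGroup V'] [Module ℚ V']
variable (P : RootSystemData V V')

theorem pair_base_coroot_nonpos {α β : V} (hα : α ∈ P.base) (hβ : β ∈ P.base) (hne : α ≠ β) :
    P.pair α (P.coroot β) ≤ 0 := by
  have key : ∀ c : V → ℚ, ∑ γ ∈ P.base, c γ • γ = 0 → ∀ γ ∈ P.base, c γ = 0 := by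
    intro c hc γ hγ
    have := Fintype.linearIndependent_iff.1 P.base_indep (fun i => c i)
      (by rw [← hc]; exact Finset.sum_coe_sort P.base fun γ => c γ • γ)
    exact this ⟨γ, hγ⟩
  have hs : ∀ δ ∈ P.base, ∑ γ ∈ P.base, (if γ = δ then (1 : ℚ) else 0) • γ = δ := by
    intro δ hδ
    simp [ite_smul, hδ]
  rcases P.root_pos_or_neg _ (P.root_reflect β (P.base_subset hβ) α (P.base_subset hα)) with
    ⟨c, hc, h⟩ | ⟨c, hc, h⟩
  · have := key (fun γ => c γ - (if γ = α then (1 : ℚ) else 0)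
        + P.pair α (P.coroot β) * (if γ = β then (1 : ℚ) else 0)) (by
      simp only [add_smul, sub_smul, mul_smul, Finset.sum_add_distrib, Finset.sum_sub_distrib,
        ← Finset.smul_sum, hs α hα, hs β hβ, ← h]
      abel) β hβ
    simp only [hne.symm, if_false, if_true] at this
    linarith [hc β]
  · have := key (fun γ => c γ + (if γ = α then (1 : ℚ) else 0)
        - P.pair α (P.coroot β) * (if γ = β then (1 : ℚ) else 0)) (by
      simp only [add_smul, sub_smul, mul_smul, Finset.sum_add_distrib, Finset.sum_sub_distrib,
        ← Finset.smul_sum, hs α hα, hs β hβ, ← h]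
      abel) α hα
    simp only [hne, if_false, if_true] at this
    linarith [hc α]

/-- The canonical map `V^∨ → V`, `y ↦ ∑_{α ∈ Φ} ⟨α, y⟩ • α`. -/
noncomputable def corootToRoot : V' →ₗ[ℚ] V := ∑ α ∈ P.roots, (P.pair α).smulRight α

theorem corootToRoot_apply (y : V') : P.corootToRoot y = ∑ α ∈ P.roots, P.pair α y • α := by
  simp [corootToRoot, LinearMap.sum_apply]

theorem reflect_reflect {α : V} (hα : α ∈ P.roots) (β : V) :
    (β - P.pair β (P.coroot α) • α)
      - P.pair (β - P.pair β (P.coroot α) • α) (P.coroot α) • α = β := by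
  simp only [map_sub, map_smul, LinearMap.sub_apply, LinearMap.smul_apply, P.pair_self α hα,
    smul_eq_mul]
  module

theorem corootToRoot_reflect {α : V} (hα : α ∈ P.roots) (y : V') :
    P.corootToRoot (y - P.pair α y • P.coroot α)
      = P.corootToRoot y - P.pair (P.corootToRoot y) (P.coroot α) • α := by
  have h : P.corootToRoot (y - P.pair α y • P.coroot α)
      = ∑ β ∈ P.roots, P.pair β y • (β - P.pair β (P.coroot α) • α) := by
    rw [corootToRoot_apply]
    refine Finset.sum_nbij' (fun β => β - P.pair β (P.coroot α) • α)
      (fun β => β - P.pair β (P.coroot α) • α) (fun β hβ => P.root_reflect α hα β hβ)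
      (fun β hβ => P.root_reflect α hα β hβ) (fun β _ => P.reflect_reflect hα β)
      (fun β _ => P.reflect_reflect hα β) (fun β _ => ?_)
    rw [P.reflect_reflect hα β]
    congr 1
    simp only [map_sub, map_smul, LinearMap.sub_apply, LinearMap.smul_apply, smul_eq_mul]
    ring
  rw [h, corootToRoot_apply]
  simp only [smul_sub, Finset.sum_sub_distrib, map_sum, LinearMap.sum_apply, map_smul,
    LinearMap.smul_apply, smul_smul, Finset.sum_smul, smul_eq_mul]

theorem exists_corootToRoot_coroot {α : V} (hα : α ∈ P.roots) :
    ∃ n : ℚ, 0 < n ∧ P.corootToRoot (P.coroot α) = n • α := by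
  refine ⟨2⁻¹ * P.pair (P.corootToRoot (P.coroot α)) (P.coroot α), ?_, ?_⟩
  · have h2 := P.pair_self α hα
    have : P.pair α (P.coroot α) * P.pair α (P.coroot α)
        ≤ P.pair (P.corootToRoot (P.coroot α)) (P.coroot α) := by
      simp only [corootToRoot_apply, map_sum, LinearMap.sum_apply, map_smul,
        LinearMap.smul_apply, smul_eq_mul]
      exact Finset.single_le_sum (f := fun β => P.pair β (P.coroot α) * P.pair β (P.coroot α))
        (fun β _ => mul_self_nonneg _) hα
    rw [h2] at this
    linarith
  · have h := P.corootToRoot_reflect hα (P.coroot α)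
    rw [P.pair_self α hα, two_smul, sub_add_cancel_left, map_neg] at h
    generalize P.pair (P.corootToRoot (P.coroot α)) (P.coroot α) = t at h ⊢
    rw [mul_smul, show t • α = (2 : ℚ) • P.corootToRoot (P.coroot α) by
      rw [two_smul, ← sub_eq_iff_eq_add, ← neg_sub, ← h, neg_neg],
      inv_smul_smul₀ two_ne_zero]

theorem base_coeff_eq_zero {S : Finset V} (hS : S ⊆ P.base) {c : V → ℚ}
    (h : ∑ β ∈ S, c β • β = 0) {β : V} (hβ : β ∈ S) : c β = 0 := by
  have h1 : LinearIndepOn ℚ id (S : Set V) :=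
    (show LinearIndepOn ℚ id (P.base : Set V) from P.base_indep).mono (Finset.coe_subset.2 hS)
  exact linearIndepOn_finset_iff.1 h1 c h β hβ

/-- A combination of simple coroots that is dominant for its support has nonnegative
coefficients. -/
theorem coeff_nonneg_of_dominant {S : Finset V} (hS : S ⊆ P.base) {x : V → ℚ}
    (h : ∀ α ∈ S, 0 ≤ P.pair α (∑ β ∈ S, x β • P.coroot β)) : ∀ β ∈ S, 0 ≤ x β := by
  have hr : ∀ β ∈ S, β ∈ P.roots := fun β hβ => P.base_subset (hS hβ)
  choose! n hn hφ using fun β (hβ : β ∈ P.roots) => P.exists_corootToRoot_coroot hβ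
  set u : V' := ∑ β ∈ S, max (-x β) 0 • P.coroot β with hu
  have hφu : P.corootToRoot u = ∑ β ∈ S, (max (-x β) 0 * n β) • β := by
    rw [hu, map_sum]
    refine Finset.sum_congr rfl fun β hβ => ?_
    rw [map_smul, hφ β (hr β hβ), smul_smul]
  have hdec : u = ∑ β ∈ S, max (x β) 0 • P.coroot β - ∑ β ∈ S, x β • P.coroot β := by
    rw [hu, ← Finset.sum_sub_distrib]
    refine Finset.sum_congr rfl fun β _ => ?_
    rw [← sub_smul]
    congr 1
    rcases le_total (x β) 0 with hx | hx
    · rw [max_eq_left (by linarith), max_eq_right hx]; ring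
    · rw [max_eq_right (by linarith), max_eq_left hx]; ring
  have hterm : ∀ β ∈ S, max (-x β) 0 * n β * P.pair β u ≤ 0 := by
    intro β hβ
    rcases le_or_gt 0 (x β) with hx | hx
    · rw [max_eq_right (by linarith)]; simp
    · refine mul_nonpos_of_nonneg_of_nonpos
        (mul_nonneg (le_max_right _ _) (hn β (hr β hβ)).le) ?_
      have h1 : P.pair β (∑ γ ∈ S, max (x γ) 0 • P.coroot γ) ≤ 0 := by
        simp only [map_sum, map_smul, smul_eq_mul]
        refine Finset.sum_nonpos fun γ hγ => ?_
        by_cases hγβ : β = γ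
        · subst hγβ; rw [max_eq_right hx.le]; simp
        · exact mul_nonpos_of_nonneg_of_nonpos (le_max_right _ _)
            (P.pair_base_coroot_nonpos (hS hβ) (hS hγ) hγβ)
      rw [hdec, map_sub]
      linarith [h β hβ]
  have hle : ∑ γ ∈ P.roots, P.pair γ u * P.pair γ u ≤ 0 := by
    have h1 : P.pair (P.corootToRoot u) u = ∑ γ ∈ P.roots, P.pair γ u * P.pair γ u := by
      simp [corootToRoot_apply, map_sum, LinearMap.sum_apply]
    rw [← h1, hφu]
    simp only [map_sum, LinearMap.sum_apply, map_smul, LinearMap.smul_apply, smul_eq_mul]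
    exact Finset.sum_nonpos hterm
  have hz : ∀ γ ∈ P.roots, P.pair γ u * P.pair γ u = 0 :=
    (Finset.sum_eq_zero_iff_of_nonneg fun γ _ => mul_self_nonneg _).1
      (le_antisymm hle (Finset.sum_nonneg fun γ _ => mul_self_nonneg _))
  have hφ0 : P.corootToRoot u = 0 := by
    rw [corootToRoot_apply]
    refine Finset.sum_eq_zero fun γ hγ => ?_
    rw [mul_self_eq_zero.1 (hz γ hγ), zero_smul]
  intro β hβ
  have h0 := P.base_coeff_eq_zero hS (hφu.symm.trans hφ0) hβ
  have := (mul_eq_zero.1 h0).resolve_right (hn β (hr β hβ)).ne'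
  linarith [le_max_left (-x β) 0]

theorem mem_span_image_finset_iff_exists_sum {ι E : Type*} [AddCommGroup E] [Module ℚ E]
    {S : Finset ι} {f : ι → E} {y : E} :
    y ∈ Submodule.span ℚ (f '' S) ↔ ∃ c : ι → ℚ, ∑ i ∈ S, c i • f i = y := by
  rw [Submodule.mem_span_image_finset_iff_exists_fun]
  constructor
  · rintro ⟨c, rfl⟩
    refine ⟨fun i => if h : i ∈ S then c ⟨i, h⟩ else 0, ?_⟩
    rw [← Finset.sum_coe_sort]
    exact Finset.sum_congr rfl fun i _ => by simp only [dif_pos i.2]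
  · rintro ⟨c, rfl⟩
    exact ⟨fun i => c i, Finset.sum_coe_sort S fun i => c i • f i⟩

/-- The span of the simple coroots attached to a set of simple roots. -/
def corootSpan (S : Finset V) : Submodule ℚ V' := Submodule.span ℚ (P.coroot '' S)

theorem coroot_mem_corootSpan {S : Finset V} {α : V} (hα : α ∈ S) :
    P.coroot α ∈ P.corootSpan S :=
  Submodule.subset_span ⟨α, hα, rfl⟩

theorem corootSpan_mono {S T : Finset V} (h : S ⊆ T) : P.corootSpan S ≤ P.corootSpan T :=
  Submodule.span_mono (Set.image_mono (by exact_mod_cast h))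

theorem mem_corootSpan_iff {S : Finset V} {y : V'} :
    y ∈ P.corootSpan S ↔ ∃ c : V → ℚ, ∑ α ∈ S, c α • P.coroot α = y :=
  mem_span_image_finset_iff_exists_sum

theorem coeff_eq_zero_of_central {S : Finset V} (hS : S ⊆ P.base) {x : V → ℚ}
    (h : ∀ α ∈ S, P.pair α (∑ β ∈ S, x β • P.coroot β) = 0) : ∀ β ∈ S, x β = 0 := by
  intro β hβ
  have h1 := P.coeff_nonneg_of_dominant hS (fun α hα => (h α hα).ge) β hβ
  have h2 := P.coeff_nonneg_of_dominant hS (x := fun γ => -x γ) (fun α hα => by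
    simp only [neg_smul, Finset.sum_neg_distrib, map_neg, h α hα, neg_zero, le_refl]) β hβ
  linarith

theorem eq_zero_of_mem_corootSpan {S : Finset V} (hS : S ⊆ P.base) {y : V'}
    (hy : y ∈ P.corootSpan S) (h : ∀ α ∈ S, P.pair α y = 0) : y = 0 := by
  obtain ⟨c, rfl⟩ := P.mem_corootSpan_iff.1 hy
  refine Finset.sum_eq_zero fun β hβ => ?_
  rw [P.coeff_eq_zero_of_central hS h β hβ, zero_smul]

theorem eq_zero_of_mem_span_base {v : V} (hv : v ∈ Submodule.span ℚ (P.base : Set V))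
    (h : ∀ β ∈ P.base, P.pair v (P.coroot β) = 0) : v = 0 := by
  choose! n hn hφ using fun β (hβ : β ∈ P.roots) => P.exists_corootToRoot_coroot hβ
  rw [← Set.image_id (P.base : Set V)] at hv
  obtain ⟨c, rfl⟩ := mem_span_image_finset_iff_exists_sum.1 hv
  have hsymm : ∀ x y : V', P.pair (P.corootToRoot x) y = P.pair (P.corootToRoot y) x := by
    intro x y
    simp [corootToRoot_apply, map_sum, LinearMap.sum_apply, mul_comm]
  have hv' : ∑ β ∈ P.base, c β • id β
      = P.corootToRoot (∑ β ∈ P.base, (c β / n β) • P.coroot β) := by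
    rw [map_sum]
    refine Finset.sum_congr rfl fun β hβ => ?_
    rw [map_smul, hφ β (P.base_subset hβ), smul_smul,
      div_mul_cancel₀ _ (hn β (P.base_subset hβ)).ne', id]
  have h0 := P.coeff_eq_zero_of_central (Finset.Subset.refl P.base) (x := fun β => c β / n β)
    fun β hβ => by
      have := h β hβ
      rw [hv', hsymm, hφ β (P.base_subset hβ), map_smul, LinearMap.smul_apply, smul_eq_mul] at this
      exact (mul_eq_zero.1 this).resolve_left (hn β (P.base_subset hβ)).ne'
  refine Finset.sum_eq_zero fun β hβ => ?_
  rw [(div_eq_zero_iff.1 (h0 β hβ)).resolve_right (hn β (P.base_subset hβ)).ne', zero_smul]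

theorem reflPair_fst_apply {α : V} (hα : α ∈ P.roots) (x : V) :
    (P.reflPair α hα).1 x = x - P.pair x (P.coroot α) • α :=
  Module.reflection_apply (f := P.pair.flip (P.coroot α)) _ (P.pair_self α hα)

theorem reflPair_snd_apply {α : V} (hα : α ∈ P.roots) (y : V') :
    (P.reflPair α hα).2 y = y - P.pair α y • P.coroot α :=
  Module.reflection_apply _ (P.pair_self α hα)

theorem reflPair_mul_self {α : V} (hα : α ∈ P.roots) :
    P.reflPair α hα * P.reflPair α hα = 1 := by
  refine Prod.ext ?_ ?_
  · ext x; exact Module.involutive_reflection (f := P.pair.flip (P.coroot α)) (P.pair_self α hα) x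
  · ext y
    exact Module.involutive_reflection (f := P.pair α) (x := P.coroot α) (P.pair_self α hα) y

/-- To prove a property of all elements of `W_M`, prove it for `1` and show that it is
preserved by left multiplication by simple reflections. -/
theorem weyl_induction {S : Finset V} {p : (V ≃ₗ[ℚ] V) × (V' ≃ₗ[ℚ] V') → Prop} (h1 : p 1)
    (hs : ∀ α (hα : α ∈ P.roots), α ∈ S → ∀ w, p w → p (P.reflPair α hα * w))
    {w : (V ≃ₗ[ℚ] V) × (V' ≃ₗ[ℚ] V')} (hw : w ∈ P.weyl S) : p w := by
  induction hw using Subgroup.closure_induction_left with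
  | one => exact h1
  | mul_left g hg w _ ih =>
    obtain ⟨α, hα, hαS, rfl⟩ := hg
    exact hs α hα hαS w ih
  | inv_mul_cancel g hg w _ ih =>
    obtain ⟨α, hα, hαS, rfl⟩ := hg
    rw [inv_eq_of_mul_eq_one_left (P.reflPair_mul_self hα)]
    exact hs α hα hαS w ih

theorem weyl_sub_mem {S : Finset V} {w : (V ≃ₗ[ℚ] V) × (V' ≃ₗ[ℚ] V')} (hw : w ∈ P.weyl S)
    (y : V') : y - w.2 y ∈ P.corootSpan S := by
  refine P.weyl_induction (p := fun w => y - w.2 y ∈ P.corootSpan S) (by simp) ?_ hw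
  intro α hα hαS w ih
  rw [Prod.snd_mul, LinearEquiv.mul_apply, reflPair_snd_apply]
  have := (P.corootSpan S).add_mem ih
    ((P.corootSpan S).smul_mem (P.pair α (w.2 y)) (P.coroot_mem_corootSpan hαS))
  convert this using 1
  abel

theorem weyl_fst_sub_mem {S : Finset V} {w : (V ≃ₗ[ℚ] V) × (V' ≃ₗ[ℚ] V')} (hw : w ∈ P.weyl S)
    (x : V) : x - w.1 x ∈ Submodule.span ℚ (S : Set V) := by
  refine P.weyl_induction (p := fun w => x - w.1 x ∈ Submodule.span ℚ (S : Set V)) (by simp) ?_ hw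
  intro α hα hαS w ih
  rw [Prod.fst_mul, LinearEquiv.mul_apply, reflPair_fst_apply]
  have := (Submodule.span ℚ (S : Set V)).add_mem ih
    (Submodule.smul_mem _ (P.pair (w.1 x) (P.coroot α)) (Submodule.subset_span hαS))
  convert this using 1
  abel

theorem weyl_fst_mem_roots {S : Finset V} {w : (V ≃ₗ[ℚ] V) × (V' ≃ₗ[ℚ] V')} (hw : w ∈ P.weyl S)
    {β : V} (hβ : β ∈ P.roots) : w.1 β ∈ P.roots := by
  refine P.weyl_induction (p := fun w => w.1 β ∈ P.roots) hβ ?_ hw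
  intro α hα _ w ih
  rw [Prod.fst_mul, LinearEquiv.mul_apply, reflPair_fst_apply]
  exact P.root_reflect α hα _ ih

theorem weyl_snd_coroot {S : Finset V} {w : (V ≃ₗ[ℚ] V) × (V' ≃ₗ[ℚ] V')} (hw : w ∈ P.weyl S)
    {β : V} (hβ : β ∈ P.roots) : w.2 (P.coroot β) = P.coroot (w.1 β) := by
  refine (P.weyl_induction (p := fun w => w.1 β ∈ P.roots ∧ w.2 (P.coroot β) = P.coroot (w.1 β))
    ⟨hβ, rfl⟩ ?_ hw).2
  rintro α hα _ w ⟨hr, ih⟩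
  rw [Prod.fst_mul, LinearEquiv.mul_apply, reflPair_fst_apply, Prod.snd_mul,
    LinearEquiv.mul_apply, reflPair_snd_apply, ih]
  exact ⟨P.root_reflect α hα _ hr, P.coroot_reflect α hα _ hr⟩

theorem weyl_pair {S : Finset V} {w : (V ≃ₗ[ℚ] V) × (V' ≃ₗ[ℚ] V')} (hw : w ∈ P.weyl S)
    (x : V) (y : V') : P.pair (w.1 x) (w.2 y) = P.pair x y := by
  refine P.weyl_induction (p := fun w => P.pair (w.1 x) (w.2 y) = P.pair x y) rfl ?_ hw
  intro α hα _ w ih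
  rw [Prod.fst_mul, LinearEquiv.mul_apply, reflPair_fst_apply, Prod.snd_mul,
    LinearEquiv.mul_apply, reflPair_snd_apply, ← ih]
  simp only [map_sub, map_smul, LinearMap.sub_apply, LinearMap.smul_apply, P.pair_self α hα,
    smul_eq_mul]
  ring

theorem weyl_eq_one_of_fix_roots {S : Finset V} (hS : S ⊆ P.base)
    {w : (V ≃ₗ[ℚ] V) × (V' ≃ₗ[ℚ] V')} (hw : w ∈ P.weyl S)
    (h : ∀ β ∈ P.roots, w.1 β = β) : w = 1 := by
  refine Prod.ext ?_ ?_
  · ext x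
    refine (sub_eq_zero.1 (P.eq_zero_of_mem_span_base (Submodule.span_mono
      (by exact_mod_cast hS) (P.weyl_fst_sub_mem hw x)) fun β hβ => ?_)).symm
    have := P.weyl_pair hw x (P.coroot β)
    rw [P.weyl_snd_coroot hw (P.base_subset hβ), h β (P.base_subset hβ)] at this
    rw [map_sub, LinearMap.sub_apply, this, sub_self]
  · ext y
    refine (sub_eq_zero.1 (P.eq_zero_of_mem_corootSpan hS (P.weyl_sub_mem hw y)
      fun α hα => ?_)).symm
    have := P.weyl_pair hw α y
    rw [h α (P.base_subset (hS hα))] at this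
    rw [map_sub, this, sub_self]

theorem finite_weyl {S : Finset V} (hS : S ⊆ P.base) : Finite (P.weyl S) := by
  refine Finite.of_injective
    (fun (w : P.weyl S) (β : P.roots) => (⟨w.1.1 β, P.weyl_fst_mem_roots w.2 β.2⟩ : P.roots)) ?_
  intro w w' hww
  have h : w⁻¹ * w' = 1 := by
    refine Subtype.ext (P.weyl_eq_one_of_fix_roots hS (w⁻¹ * w').2 fun β hβ => ?_)
    have h1 : w.1.1 β = w'.1.1 β := congrArg Subtype.val (congrFun hww ⟨β, hβ⟩)
    change w.1.1.symm (w'.1.1 β) = β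
    rw [← h1, LinearEquiv.symm_apply_apply]
  exact inv_mul_eq_one.1 h

theorem pair_avg {S : Finset V} (hS : S ⊆ P.base) (ν : V') {α : V} (hα : α ∈ S) :
    P.pair α (P.avg S ν) = 0 := by
  have := P.finite_weyl hS
  have := Fintype.ofFinite (P.weyl S)
  have hr := P.base_subset (hS hα)
  rw [avg, finsum_eq_sum_of_fintype, map_smul]
  set y := ∑ w : P.weyl S, (w : (V ≃ₗ[ℚ] V) × (V' ≃ₗ[ℚ] V')).2 ν with hy
  have hfix : (P.reflPair α hr).2 y = y := by
    rw [hy, map_sum]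
    exact Fintype.sum_equiv
      (Equiv.mulLeft (⟨P.reflPair α hr, Subgroup.subset_closure ⟨α, hr, hα, rfl⟩⟩ : P.weyl S))
      _ _ fun w => rfl
  have h := congrArg (P.pair α) hfix
  rw [reflPair_snd_apply, map_sub, map_smul, P.pair_self α hr, smul_eq_mul] at h
  rw [show P.pair α y = 0 by linarith, smul_zero]

theorem sub_avg_mem {S : Finset V} (hS : S ⊆ P.base) (ν : V') :
    ν - P.avg S ν ∈ P.corootSpan S := by
  have := P.finite_weyl hS
  have := Fintype.ofFinite (P.weyl S)
  have hcard : (Nat.card (P.weyl S) : ℚ) ≠ 0 := by exact_mod_cast Nat.card_pos.ne'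
  have h : ν - P.avg S ν = (Nat.card (P.weyl S) : ℚ)⁻¹ •
      ∑ w : P.weyl S, (ν - (w : (V ≃ₗ[ℚ] V) × (V' ≃ₗ[ℚ] V')).2 ν) := by
    rw [avg, finsum_eq_sum_of_fintype, Finset.sum_sub_distrib, smul_sub, Finset.sum_const,
      Finset.card_univ, ← Nat.card_eq_fintype_card, ← Nat.cast_smul_eq_nsmul ℚ,
      inv_smul_smul₀ hcard]
  rw [h]
  exact Submodule.smul_mem _ _ (Submodule.sum_mem _ fun w _ => P.weyl_sub_mem w.2 ν)

/-- The `M`-average of `ν` is the unique `M`-central vector congruent to `ν` modulo the span of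
the simple coroots of `M`. -/
theorem avg_eq {S : Finset V} (hS : S ⊆ P.base) {ν μ : V'}
    (hμ : ∀ α ∈ S, P.pair α μ = 0) (h : ν - μ ∈ P.corootSpan S) : P.avg S ν = μ := by
  refine sub_eq_zero.1 (P.eq_zero_of_mem_corootSpan hS ?_ fun α hα => ?_)
  · have := (P.corootSpan S).sub_mem h (P.sub_avg_mem hS ν)
    rwa [sub_sub_sub_cancel_left] at this
  · rw [map_sub, P.pair_avg hS ν hα, hμ α hα, sub_self]

theorem avg_avg {S T : Finset V} (hST : S ⊆ T) (hT : T ⊆ P.base) (ν : V') :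
    P.avg T (P.avg S ν) = P.avg T ν := by
  refine (P.avg_eq hT (fun α hα => P.pair_avg hT _ hα) ?_).symm
  have := (P.corootSpan T).add_mem (P.corootSpan_mono hST (P.sub_avg_mem (hST.trans hT) ν))
    (P.sub_avg_mem hT (P.avg S ν))
  rwa [sub_add_sub_cancel] at this

theorem isNonneg_avg {S : Finset V} (hS : S ⊆ P.base) {ν : V'} (hν : P.IsNonneg ν) :
    P.IsNonneg (P.avg S ν) := by
  obtain ⟨z, c, hz, hc, hνe⟩ := hν
  obtain ⟨d, hd⟩ := P.mem_corootSpan_iff.1 (P.sub_avg_mem hS ν)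
  have hsplit : ∑ α ∈ P.base, c α • P.coroot α
      = ∑ α ∈ P.base \ S, c α • P.coroot α + ∑ α ∈ S, c α • P.coroot α :=
    (Finset.sum_sdiff hS).symm
  have havg : P.avg S ν = z + ∑ α ∈ P.base \ S, c α • P.coroot α
      + ∑ α ∈ S, (c α - d α) • P.coroot α := by
    simp only [sub_smul, Finset.sum_sub_distrib]
    rw [hd]
    nth_rw 2 [hνe]
    rw [hsplit]
    abel
  have hpos : ∀ α ∈ S, 0 ≤ c α - d α := by
    refine P.coeff_nonneg_of_dominant hS (x := fun α => c α - d α) fun α hα => ?_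
    have h0 := P.pair_avg hS ν hα
    rw [havg, map_add, map_add, hz α (P.base_subset (hS hα))] at h0
    have h1 : P.pair α (∑ β ∈ P.base \ S, c β • P.coroot β) ≤ 0 := by
      simp only [map_sum, map_smul, smul_eq_mul]
      refine Finset.sum_nonpos fun β hβ => mul_nonpos_of_nonneg_of_nonpos (hc β) ?_
      rw [Finset.mem_sdiff] at hβ
      exact P.pair_base_coroot_nonpos (hS hα) hβ.1 (by rintro rfl; exact hβ.2 hα)
    linarith
  refine ⟨z, fun α => if α ∈ S then c α - d α else c α, hz, fun α => ?_, ?_⟩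
  · dsimp only
    split_ifs with hα
    exacts [hpos α hα, hc α]
  · rw [havg, ← Finset.sum_sdiff hS, add_assoc]
    congr 2
    · refine Finset.sum_congr rfl fun α hα => ?_
      simp only [if_neg (Finset.mem_sdiff.1 hα).2]
    · refine Finset.sum_congr rfl fun α hα => ?_
      simp only [if_pos hα]

theorem pair_eq_zero_of_nonpos {ν : V'} (hν : P.IsNonneg ν)
    (h : ∀ α ∈ P.base, P.pair α ν ≤ 0) : ∀ α ∈ P.base, P.pair α ν = 0 := by
  obtain ⟨z, c, hz, hc, rfl⟩ := hν
  have h1 := P.coeff_nonneg_of_dominant (Finset.Subset.refl P.base) (x := fun α => -c α)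
    fun α hα => by
      have := h α hα
      rw [map_add, hz α (P.base_subset hα), zero_add] at this
      simpa only [neg_smul, Finset.sum_neg_distrib, map_neg, neg_nonneg] using this
  intro α hα
  rw [map_add, hz α (P.base_subset hα), zero_add, Finset.sum_eq_zero, map_zero]
  intro β hβ
  rw [show c β = 0 by linarith [hc β, h1 β hβ], zero_smul]

theorem map_avg_eq {S : Finset V} (hS : S ⊆ P.base) {Γ : Type} [Group Γ]
    {σ : Γ →* (V ≃ₗ[ℚ] V)} {σ' : Γ →* (V' ≃ₗ[ℚ] V')}
    (hcompat : ∀ (γ : Γ) (x : V) (y : V'), P.pair (σ γ x) (σ' γ y) = P.pair x y)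
    (hcoroots : ∀ γ : Γ, ∀ β ∈ P.roots, σ' γ (P.coroot β) = P.coroot (σ γ β))
    (hstable : ∀ γ : Γ, ∀ α ∈ S, σ γ α ∈ S) {ν : V'} (hinv : ∀ γ : Γ, σ' γ ν = ν) (γ : Γ) :
    σ' γ (P.avg S ν) = P.avg S ν := by
  refine (P.avg_eq hS (fun α hα => ?_) ?_).symm
  · have := hcompat γ (σ γ⁻¹ α) (P.avg S ν)
    rw [← LinearEquiv.mul_apply, ← map_mul, mul_inv_cancel, map_one, LinearEquiv.coe_one, id,
      P.pair_avg hS ν (hstable γ⁻¹ α hα)] at this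
    exact this
  · obtain ⟨d, hd⟩ := P.mem_corootSpan_iff.1 (P.sub_avg_mem hS ν)
    nth_rw 1 [← hinv γ]
    rw [← map_sub, ← hd, map_sum]
    refine Submodule.sum_mem _ fun α hα => ?_
    rw [map_smul, hcoroots γ α (P.base_subset (hS hα))]
    exact Submodule.smul_mem _ _ (P.coroot_mem_corootSpan (hstable γ α hα))

end Averages

end RootSystemData

namespace RootSystemData

variable {V V' : Type} [AddCommGroup V] [Module ℚ V] [AddCommGroup V'] [Module ℚ V']
variable [FiniteDimensional ℚ V] [FiniteDimensional ℚ V']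
variable (P : RootSystemData V V')

/-- given a finite group `Γ` acting linearly and compatibly on `V` and `V^∨`,
preserving `Φ`, `Φ^∨` (with `γ·(α^∨) = (γ·α)^∨`) and `Δ`, a `Γ`-stable subset `Δ_M ⊆ Δ`, and a
non-negative, `Γ`-invariant, `M`-central vector `ν ∈ V^∨`, there are a chain of `Γ`-stable
subsets `Δ_M = Δ_0 ⊆ Δ_1 ⊆ ⋯ ⊆ Δ_k = Δ` and `Γ`-invariant non-negative vectors
`ν = ν_0, ν_1, …, ν_k = av_G(ν)` in `V^∨` such that (1) `ν_j = av_{M_j}(ν_i)` for all `j ≥ i`,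
and (2) `ν_i` is `M_{i+1}`-dominant, i.e. `⟨α, ν_i⟩ ≥ 0` for all `α ∈ Δ_{i+1}`. -/
theorem exists_chain_of_levis (Γ : Type) [Group Γ] [Fintype Γ]
    (σ : Γ →* (V ≃ₗ[ℚ] V)) (σ' : Γ →* (V' ≃ₗ[ℚ] V'))
    (hcompat : ∀ (γ : Γ) (x : V) (y : V'), P.pair (σ γ x) (σ' γ y) = P.pair x y)
    (hroots : ∀ γ : Γ, ∀ β ∈ P.roots, σ γ β ∈ P.roots)
    (hcoroots : ∀ γ : Γ, ∀ β ∈ P.roots, σ' γ (P.coroot β) = P.coroot (σ γ β))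
    (hbase : ∀ γ : Γ, ∀ α ∈ P.base, σ γ α ∈ P.base)
    (ΔM : Finset V) (hM : ΔM ⊆ P.base)
    (hMstable : ∀ γ : Γ, ∀ α ∈ ΔM, σ γ α ∈ ΔM)
    (ν : V') (hν : P.IsNonneg ν)
    (hinv : ∀ γ : Γ, σ' γ ν = ν)
    (hcen : ∀ α ∈ ΔM, P.pair α ν = 0) :
    ∃ (k : ℕ) (Δc : Fin (k + 1) → Finset V) (νs : Fin (k + 1) → V'),
      Δc 0 = ΔM ∧ Δc (Fin.last k) = P.base ∧
      νs 0 = ν ∧ νs (Fin.last k) = P.avg P.base ν ∧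
      (∀ i j : Fin (k + 1), i ≤ j → Δc i ⊆ Δc j) ∧
      (∀ i : Fin (k + 1), Δc i ⊆ P.base) ∧
      (∀ i : Fin (k + 1), ∀ γ : Γ, ∀ α ∈ Δc i, σ γ α ∈ Δc i) ∧
      (∀ i : Fin (k + 1), ∀ γ : Γ, σ' γ (νs i) = νs i) ∧
      (∀ i : Fin (k + 1), P.IsNonneg (νs i)) ∧
      (∀ i j : Fin (k + 1), i ≤ j → νs j = P.avg (Δc j) (νs i)) ∧
      (∀ i : Fin k, ∀ α ∈ Δc i.succ, 0 ≤ P.pair α (νs i.castSucc)) := by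
  clear hroots
  induction hn : (P.base \ ΔM).card using Nat.strong_induction_on generalizing ΔM ν with
  | _ n ih =>
  subst hn
  have havg : P.avg ΔM ν = ν := P.avg_eq hM hcen (by simp)
  by_cases hMb : ΔM = P.base
  · refine ⟨0, fun _ => ΔM, fun _ => ν, rfl, hMb, rfl, by rw [← hMb, havg],
      fun _ _ _ => subset_rfl, fun _ => hM, fun _ => hMstable, fun _ => hinv, fun _ => hν,
      fun _ _ _ => havg.symm, fun i => i.elim0⟩
  set T := P.base.filter fun α => 0 ≤ P.pair α ν with hT
  have hTb : T ⊆ P.base := Finset.filter_subset _ _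
  have hMT : ΔM ⊆ T := fun α hα => Finset.mem_filter.2 ⟨hM hα, (hcen α hα).ge⟩
  have hTstable : ∀ γ : Γ, ∀ α ∈ T, σ γ α ∈ T := by
    intro γ α hα
    obtain ⟨h1, h2⟩ := Finset.mem_filter.1 hα
    refine Finset.mem_filter.2 ⟨hbase γ α h1, ?_⟩
    rw [← hinv γ, hcompat]
    exact h2
  have hss : ΔM ⊂ T := by
    refine hMT.ssubset_of_ne fun heq => hMb (hM.antisymm fun α hα => ?_)
    have hcentral := P.pair_eq_zero_of_nonpos hν fun β hβ => by
      by_cases hβM : β ∈ ΔM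
      · exact (hcen β hβM).le
      · rw [heq, hT, Finset.mem_filter, not_and, not_le] at hβM
        exact (hβM hβ).le
    rw [heq]
    exact Finset.mem_filter.2 ⟨hα, (hcentral α hα).ge⟩
  have hlt : (P.base \ T).card < (P.base \ ΔM).card := by
    have h1 := Finset.card_lt_card hss
    have h2 := Finset.card_le_card hTb
    rw [Finset.card_sdiff_of_subset hTb, Finset.card_sdiff_of_subset hM]
    omega
  obtain ⟨k, Δc, νs, h0, hl, hν0, hνl, hmono, hsub, hst, hi, hnn, hav, hdom⟩ :=
    ih _ hlt T hTb hTstable (P.avg T ν) (P.isNonneg_avg hTb hν)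
      (P.map_avg_eq hTb hcompat hcoroots hTstable hinv) (fun α hα => P.pair_avg hTb ν hα) rfl
  have hTc : ∀ j, T ⊆ Δc j := fun j => h0 ▸ hmono 0 j (Fin.zero_le j)
  have hfirst : ∀ j, νs j = P.avg (Δc j) ν := fun j => by
    rw [hav 0 j (Fin.zero_le j), hν0, P.avg_avg (hTc j) (hsub j)]
  refine ⟨k + 1, Fin.cons ΔM Δc, Fin.cons ν νs, rfl, ?_, rfl, ?_, ?_, ?_, ?_, ?_, ?_, ?_, ?_⟩
  · rw [← Fin.succ_last, Fin.cons_succ, hl]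
  · rw [← Fin.succ_last, Fin.cons_succ, hfirst, hl]
  · intro i j hij
    cases i using Fin.cases with
    | zero =>
      cases j using Fin.cases with
      | zero => exact subset_rfl
      | succ j => exact hMT.trans (hTc j)
    | succ i =>
      cases j using Fin.cases with
      | zero => exact absurd hij (by simp)
      | succ j => exact hmono i j (Fin.succ_le_succ_iff.1 hij)
  · exact Fin.cases hM hsub
  · exact Fin.cases hMstable hst
  · exact Fin.cases hinv hi
  · exact Fin.cases hν hnn
  · intro i j hij
    cases i using Fin.cases with
    | zero =>
      cases j using Fin.cases with
      | zero => exact havg.symm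
      | succ j => exact hfirst j
    | succ i =>
      cases j using Fin.cases with
      | zero => exact absurd hij (by simp)
      | succ j => exact hav i j (Fin.succ_le_succ_iff.1 hij)
  · intro i
    cases i using Fin.cases with
    | zero =>
      intro α hα
      rw [Fin.cons_succ, h0] at hα
      exact (Finset.mem_filter.1 hα).2
    | succ i => exact hdom i

end RootSystemData
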